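/- Fix m ≥ 1 and let μ, ν be Borel probability measures on ℝ^m (functions from Fin m to ℝ) with finite second moments, each of which is the product of its coordinate marginals, i.e., μ = ⊗_{l=1}^m (π_l#μ) and ν = ⊗_{l=1}^m (π_l#ν). If HSWD(μ,ν) = 0, where HSWD(μ,ν) = ((1/m) Σ_{l=1}^m W(π_l#μ, π_l#ν)²)^{1/2} with W the one-dimensional Wasserstein-2 distance defined via quantile functions, then μ = ν. -/

import Mathlib

open MeasureTheory Set

/-- Cumulative distribution function of a measure on ℝ: `F_μ(x) = μ((−∞, x])`. -/
noncomputable def cdfFn (μ : Measure ℝ) (x : ℝ) : ℝ := (μ (Iic x)).toReal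

/-- Quantile function of a measure on ℝ: `Q_μ(t) = inf {x | t ≤ F_μ(x)}`. -/
noncomputable def quantileFn (μ : Measure ℝ) (t : ℝ) : ℝ := sInf {x : ℝ | t ≤ cdfFn μ x}

/-- The one-dimensional Wasserstein-2 distance between measures on ℝ, given in closed form
via quantile functions: `W(μ,ν) = (∫₀¹ (Q_μ(t) − Q_ν(t))² dt)^{1/2}`. -/
noncomputable def W2 (μ ν : Measure ℝ) : ℝ :=
  Real.sqrt (∫ t in Ioo (0 : ℝ) 1, (quantileFn μ t - quantileFn ν t) ^ 2)

/-- The HSWD distance between measures on `ℝ^m`: the root-mean-square of the one-dimensional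
Wasserstein-2 distances between the coordinate marginals,
`HSWD(μ,ν) = ((1/m) Σ_l W(π_l#μ, π_l#ν)²)^{1/2}`. -/
noncomputable def HSWD (m : ℕ) (μ ν : Measure (Fin m → ℝ)) : ℝ :=
  Real.sqrt ((1 / (m : ℝ)) *
    ∑ l : Fin m, (W2 (Measure.map (fun x => x l) μ) (Measure.map (fun x => x l) ν)) ^ 2)

theorem cdfFn_eq_cdf (μ : Measure ℝ) [IsProbabilityMeasure μ] (x : ℝ) :
    cdfFn μ x = ProbabilityTheory.cdf μ x :=
  (ProbabilityTheory.cdf_eq_real μ x).symm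

theorem bddBelow_setOf_le_cdfFn (μ : Measure ℝ) [IsProbabilityMeasure μ] {t : ℝ} (ht : 0 < t) :
    BddBelow {x : ℝ | t ≤ cdfFn μ x} := by
  obtain ⟨y, hy⟩ := ((ProbabilityTheory.tendsto_cdf_atBot μ).eventually (gt_mem_nhds ht)).exists
  refine ⟨y, fun x hx => ?_⟩
  by_contra! hxy
  have hmono := ProbabilityTheory.monotone_cdf μ hxy.le
  rw [mem_ofPred_eq, cdfFn_eq_cdf] at hx
  linarith

theorem nonempty_setOf_le_cdfFn (μ : Measure ℝ) [IsProbabilityMeasure μ] {t : ℝ} (ht : t < 1) :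
    {x : ℝ | t ≤ cdfFn μ x}.Nonempty := by
  obtain ⟨y, hy⟩ := ((ProbabilityTheory.tendsto_cdf_atTop μ).eventually (lt_mem_nhds ht)).exists
  exact ⟨y, by simpa only [mem_ofPred_eq, cdfFn_eq_cdf] using hy.le⟩

theorem quantileFn_le_iff (μ : Measure ℝ) [IsProbabilityMeasure μ] {t : ℝ} (ht : t ∈ Ioo 0 1)
    (x : ℝ) : quantileFn μ t ≤ x ↔ t ≤ cdfFn μ x := by
  refine ⟨fun h => ?_, fun h => csInf_le (bddBelow_setOf_le_cdfFn μ ht.1) h⟩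
  rw [cdfFn_eq_cdf]
  have hlim : Filter.Tendsto (ProbabilityTheory.cdf μ) (nhdsWithin x (Ioi x))
      (nhds (ProbabilityTheory.cdf μ x)) :=
    ((ProbabilityTheory.cdf μ).right_continuous x).mono Ioi_subset_Ici_self
  refine ge_of_tendsto hlim (eventually_nhdsWithin_of_forall fun z hz => ?_)
  obtain ⟨y, hy, hyz⟩ := exists_lt_of_csInf_lt (nonempty_setOf_le_cdfFn μ ht.2) (h.trans_lt hz)
  rw [mem_ofPred_eq, cdfFn_eq_cdf] at hy
  exact hy.trans (ProbabilityTheory.monotone_cdf μ hyz.le)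

theorem aemeasurable_quantileFn (μ : Measure ℝ) [IsProbabilityMeasure μ] :
    AEMeasurable (quantileFn μ) (volume.restrict (Ioo (0 : ℝ) 1)) := by
  refine aemeasurable_restrict_of_monotoneOn measurableSet_Ioo fun s hs t ht hst => ?_
  rw [quantileFn_le_iff μ hs]
  exact hst.trans ((quantileFn_le_iff μ ht _).1 le_rfl)

/-- The quantile function pushes the uniform measure on `(0, 1)` forward to the measure. -/
theorem map_quantileFn (μ : Measure ℝ) [IsProbabilityMeasure μ] :
    (volume.restrict (Ioo (0 : ℝ) 1)).map (quantileFn μ) = μ := by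
  refine (Measure.ext_of_Iic _ _ fun x => ?_).symm
  have hle : cdfFn μ x ≤ 1 := by
    rw [cdfFn_eq_cdf]
    exact ProbabilityTheory.cdf_le_one μ x
  have hset : (quantileFn μ ⁻¹' Iic x ∩ Ioo 0 1 : Set ℝ) = Iic (cdfFn μ x) ∩ Ioo 0 1 := by
    ext t
    exact and_congr_left fun ht => quantileFn_le_iff μ ht x
  have hvol : volume (Iic (cdfFn μ x) ∩ Ioo (0 : ℝ) 1) = volume (Ioc (0 : ℝ) (cdfFn μ x)) := by
    rw [← Measure.restrict_apply measurableSet_Iic, restrict_Ioo_eq_restrict_Ioc,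
      Measure.restrict_apply measurableSet_Iic]
    congr 1
    ext t
    simp only [mem_inter_iff, mem_Iic, mem_Ioc]
    exact ⟨fun h => ⟨h.2.1, h.1⟩, fun h => ⟨h.2, h.1, h.2.trans hle⟩⟩
  rw [Measure.map_apply_of_aemeasurable (aemeasurable_quantileFn μ) measurableSet_Iic,
    Measure.restrict_apply' measurableSet_Ioo, hset, hvol, Real.volume_Ioc, sub_zero, cdfFn,
    ENNReal.ofReal_toReal (measure_ne_top μ _)]

theorem memLp_quantileFn (μ : Measure ℝ) [IsProbabilityMeasure μ] (h : MemLp id 2 μ) :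
    MemLp (quantileFn μ) 2 (volume.restrict (Ioo (0 : ℝ) 1)) := by
  rw [← map_quantileFn μ] at h
  exact h.comp_of_map (aemeasurable_quantileFn μ)

theorem W2_eq_zero_imp_eq (μ ν : Measure ℝ) [IsProbabilityMeasure μ] [IsProbabilityMeasure ν]
    (hμ : MemLp id 2 μ) (hν : MemLp id 2 ν) (h : W2 μ ν = 0) : μ = ν := by
  have hint := ((memLp_quantileFn μ hμ).sub (memLp_quantileFn ν hν)).integrable_sq
  have hzero := (Real.sqrt_eq_zero (integral_nonneg fun _ => sq_nonneg _)).1 h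
  have hae := (integral_eq_zero_iff_of_nonneg (fun _ => sq_nonneg _) hint).1 hzero
  rw [← map_quantileFn μ, ← map_quantileFn ν]
  refine Measure.map_congr ?_
  filter_upwards [hae] with t ht
  exact sub_eq_zero.1 (pow_eq_zero_iff two_ne_zero |>.1 ht)

theorem W2_eq_zero_of_HSWD_eq_zero {m : ℕ} {μ ν : Measure (Fin m → ℝ)} (h : HSWD m μ ν = 0)
    (l : Fin m) : W2 (μ.map (fun x => x l)) (ν.map (fun x => x l)) = 0 := by
  have hm : (1 / (m : ℝ)) ≠ 0 := one_div_ne_zero (Nat.cast_ne_zero.2 l.pos.ne')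
  have hsum := (mul_eq_zero.1 ((Real.sqrt_eq_zero (by positivity)).1 h)).resolve_left hm
  exact pow_eq_zero_iff two_ne_zero |>.1
    ((Finset.sum_eq_zero_iff_of_nonneg fun _ _ => sq_nonneg _).1 hsum l (Finset.mem_univ l))

theorem memLp_id_map_eval {m : ℕ} {μ : Measure (Fin m → ℝ)}
    (h : Integrable (fun x : Fin m → ℝ => ‖x‖ ^ 2) μ) (l : Fin m) :
    MemLp id 2 (μ.map (fun x => x l)) := by
  have hmeas : Measurable (fun x : Fin m → ℝ => x l) := measurable_pi_apply l
  rw [memLp_map_measure_iff aestronglyMeasurable_id hmeas.aemeasurable]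
  have hid : MemLp (fun x : Fin m → ℝ => x) 2 μ :=
    (memLp_two_iff_integrable_sq_norm aestronglyMeasurable_id).2 h
  exact hid.mono hmeas.aestronglyMeasurable (ae_of_all _ fun x => norm_le_pi_norm x l)

/-- If two Borel probability measures on `ℝ^m` with finite second moments are each the
product of their coordinate marginals, then vanishing HSWD implies equality. -/
theorem HSWD_eq_zero_imp_eq_of_product (m : ℕ) (hm : 1 ≤ m) (μ ν : Measure (Fin m → ℝ))
    [IsProbabilityMeasure μ] [IsProbabilityMeasure ν]
    (hμ2 : Integrable (fun x : Fin m → ℝ => ‖x‖ ^ 2) μ)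
    (hν2 : Integrable (fun x : Fin m → ℝ => ‖x‖ ^ 2) ν)
    (hμprod : μ = Measure.pi (fun l : Fin m => Measure.map (fun x => x l) μ))
    (hνprod : ν = Measure.pi (fun l : Fin m => Measure.map (fun x => x l) ν))
    (h : HSWD m μ ν = 0) :
    μ = ν := by
  rw [hμprod, hνprod]
  congr 1
  funext l
  have := Measure.isProbabilityMeasure_map (μ := μ) (measurable_pi_apply l).aemeasurable
  have := Measure.isProbabilityMeasure_map (μ := ν) (measurable_pi_apply l).aemeasurable
  exact W2_eq_zero_imp_eq _ _ (memLp_id_map_eval hμ2 l) (memLp_id_map_eval hν2 l)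
    (W2_eq_zero_of_HSWD_eq_zero h l)
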